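/- arXiv:2007.11518 — 2 statements merged into one kernel-verified Lean document; each statement's English description precedes it below -/
import Mathlib

section
/- Let A be a 2×2 integer matrix with determinant 1 and trace > 2. Then there exist two disjoint periodic orbits 𝒳 and 𝒴 of f_A such that there exists a positive 𝒳-rectangle disjoint from the lift 𝒴̃ and there exists a negative 𝒴-rectangle disjoint from the lift 𝒳̃. -/
/- Common setup: following the paper, we identify each subset of the torus
`𝕋² = ℝ²/ℤ²` with its (`ℤ²`-saturated) lift to `ℝ²`. -/

open Matrix Set
open scoped Pointwise

namespace Paper

/-- Points of the plane ℝ². -/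
abbrev V : Type := Fin 2 → ℝ

/-- The integer lattice ℤ² ⊆ ℝ². -/
def lattice : Set V := Set.range fun m : Fin 2 → ℤ => fun i => (m i : ℝ)

/-- The linear action of an integer matrix on ℝ². -/
def actR (A : Matrix (Fin 2) (Fin 2) ℤ) (v : V) : V :=
  (A.map (Int.cast : ℤ → ℝ)).mulVec v

/-- `E ⊆ ℝ²` is the lift of a finite subset of the torus. -/
def IsTorusFinite (E : Set V) : Prop := ∃ F : Set V, F.Finite ∧ E = F + lattice

/-- `E` is the lift of an `f_A`-invariant subset of the torus. -/
def IsInvariant (A : Matrix (Fin 2) (Fin 2) ℤ) (E : Set V) : Prop := actR A '' E = E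

/-- `E` is the lift of a periodic orbit of `f_A`. -/
def IsPeriodicOrbit (A : Matrix (Fin 2) (Fin 2) ℤ) (E : Set V) : Prop :=
  ∃ x : V, ∃ p : ℕ, 0 < p ∧ (actR A)^[p] x - x ∈ lattice ∧
    E = {v | ∃ i : ℕ, v - (actR A)^[i] x ∈ lattice}

/-- A rectangle `R(p; s, u)`, recorded via its basepoint `p` and its side
lengths `s, u > 0` (in the directions of the fixed eigenvectors `v^s, v^u`). -/
structure Rect where
  p : V
  s : ℝ
  u : ℝ
  s_pos : 0 < s
  u_pos : 0 < u

namespace Rect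

/-- The set of points of the rectangle `R(p;s,u)`. -/
def carrier (vs vu : V) (R : Rect) : Set V :=
  {q | ∃ a b : ℝ, 0 ≤ a ∧ a ≤ R.s ∧ 0 ≤ b ∧ b ≤ R.u ∧ q = R.p + a • vs + b • vu}

/-- Endpoint of the increasing diagonal (whose origin is `R.p`). -/
def incEnd (vs vu : V) (R : Rect) : V := R.p + R.s • vs + R.u • vu

/-- Origin of the decreasing diagonal. -/
def decOrigin (vs : V) (R : Rect) : V := R.p + R.s • vs

/-- Endpoint of the decreasing diagonal. -/
def decEnd (vu : V) (R : Rect) : V := R.p + R.u • vu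

/-- `R` is a positive `E`-rectangle. -/
def IsPos (vs vu : V) (E : Set V) (R : Rect) : Prop :=
  R.p ∈ E ∧ R.incEnd vs vu ∈ E

/-- `R` is a negative `E`-rectangle. -/
def IsNeg (vs vu : V) (E : Set V) (R : Rect) : Prop :=
  R.decOrigin vs ∈ E ∧ R.decEnd vu ∈ E

/-- `R` is a primitive positive `E`-rectangle. -/
def IsPrimPos (vs vu : V) (E : Set V) (R : Rect) : Prop :=
  R.IsPos vs vu E ∧ R.carrier vs vu ∩ E = {R.p, R.incEnd vs vu}

/-- `R` is a primitive negative `E`-rectangle. -/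
def IsPrimNeg (vs vu : V) (E : Set V) (R : Rect) : Prop :=
  R.IsNeg vs vu E ∧ R.carrier vs vu ∩ E = {R.decOrigin vs, R.decEnd vu}

/-- Bottom stable side of a rectangle. -/
def botSide (vs : V) (R : Rect) : Set V :=
  {q | ∃ a : ℝ, 0 ≤ a ∧ a ≤ R.s ∧ q = R.p + a • vs}

/-- Top stable side of a rectangle. -/
def topSide (vs vu : V) (R : Rect) : Set V :=
  {q | ∃ a : ℝ, 0 ≤ a ∧ a ≤ R.s ∧ q = R.p + a • vs + R.u • vu}

/-- Left unstable side of a rectangle. -/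
def leftSide (vu : V) (R : Rect) : Set V :=
  {q | ∃ b : ℝ, 0 ≤ b ∧ b ≤ R.u ∧ q = R.p + b • vu}

/-- Interior of a rectangle. -/
def interior (vs vu : V) (R : Rect) : Set V :=
  {q | ∃ a b : ℝ, 0 < a ∧ a < R.s ∧ 0 < b ∧ b < R.u ∧ q = R.p + a • vs + b • vu}

end Rect

/-- The (closed) quadrant `C₊₊(x)`. -/
def quadPP (vs vu x : V) : Set V :=
  {q | ∃ a b : ℝ, 0 ≤ a ∧ 0 ≤ b ∧ q = x + a • vs + b • vu}

/-- `D` is a right horizontal subrectangle of `R`. -/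
def IsRightHorizSub (vs : V) (D R : Rect) : Prop :=
  D.s ≤ R.s ∧ D.u = R.u ∧ D.p = R.p + (R.s - D.s) • vs

/-- A positive `X`-string with origin `x`: a sequence of positive `X`-rectangles,
the first one having `x` as origin of its increasing diagonal, consecutive ones
meeting exactly at one point which is the endpoint of the increasing diagonal of
the former and the origin of the increasing diagonal of the latter. -/
def IsPosString (vs vu : V) (X : Set V) (x : V) (R : ℕ → Rect) : Prop :=
  (∀ i, (R i).IsPos vs vu X) ∧ (R 0).p = x ∧
    ∀ i, (R i).carrier vs vu ∩ (R (i + 1)).carrier vs vu = {(R i).incEnd vs vu} ∧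
      (R (i + 1)).p = (R i).incEnd vs vu

/-- A positive `X`-staircase with origin `x`. -/
def IsPosStaircase (vs vu : V) (X : Set V) (x : V) (R : ℕ → Rect) : Prop :=
  (∀ i, (R i).carrier vs vu ⊆ quadPP vs vu x) ∧
    ∃ Del : ℕ → Rect, IsPosString vs vu X x Del ∧ R 0 = Del 0 ∧
      (∀ i, 1 ≤ i → IsRightHorizSub vs (Del i) (R i)) ∧
      (∀ i, (R i).topSide vs vu ⊆ (R (i + 1)).botSide vs) ∧
      ∃ C : ℝ, ∀ i, (Del (i + 1)).s / (Del i).s ≤ C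

/-- Stable side lengths of the primitive positive `(X, x)`-rectangles. -/
def baseLengths (vs vu : V) (X : Set V) (x : V) : Set ℝ :=
  {s | ∃ R : Rect, R.IsPrimPos vs vu X ∧ R.p = x ∧ R.s = s}

/-- The Euclidean norm of a point of ℝ². -/
noncomputable def euclNorm (v : V) : ℝ := Real.sqrt ((v 0) ^ 2 + (v 1) ^ 2)

/-- `Y` is the lift of an `ε`-dense subset of the torus, for the metric on the
torus induced by the Euclidean metric of ℝ². -/
def EDense (ε : ℝ) (Y : Set V) : Prop := ∀ v : V, ∃ y ∈ Y, euclNorm (v - y) ≤ ε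

/-- The lift of `{(0,1/2), (1/2,0), (1/2,1/2)}`, i.e. the set
`{(0,1/2), (1/2,0), (1/2,1/2)} + ℤ²`. -/
def halfPoints : Set V :=
  {v : V | ∃ w ∈ ({![0, 1/2], ![1/2, 0], ![1/2, 1/2]} : Set V), v - w ∈ lattice}

/-- The lift of the point `(1/2,1/2)` of the torus, i.e. `(1/2,1/2) + ℤ²`. -/
def halfCenter : Set V := {v : V | v - ![1/2, 1/2] ∈ lattice}

/-! ### The lattice and the linear action -/

lemma add_mem_lattice {v w : V} (hv : v ∈ lattice) (hw : w ∈ lattice) : v + w ∈ lattice := by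
  obtain ⟨m, rfl⟩ := hv
  obtain ⟨n, rfl⟩ := hw
  exact ⟨m + n, by ext i; simp⟩

lemma neg_mem_lattice {v : V} (hv : v ∈ lattice) : -v ∈ lattice := by
  obtain ⟨m, rfl⟩ := hv
  exact ⟨-m, by ext i; simp⟩

lemma sub_mem_lattice {v w : V} (hv : v ∈ lattice) (hw : w ∈ lattice) : v - w ∈ lattice := by
  simpa [sub_eq_add_neg] using add_mem_lattice hv (neg_mem_lattice hw)

lemma zero_mem_lattice : (0 : V) ∈ lattice := ⟨0, by ext i; simp⟩

lemma actR_add (A : Matrix (Fin 2) (Fin 2) ℤ) (v w : V) :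
    actR A (v + w) = actR A v + actR A w := Matrix.mulVec_add _ _ _

lemma actR_sub (A : Matrix (Fin 2) (Fin 2) ℤ) (v w : V) :
    actR A (v - w) = actR A v - actR A w := Matrix.mulVec_sub _ _ _

lemma actR_smul (A : Matrix (Fin 2) (Fin 2) ℤ) (c : ℝ) (v : V) :
    actR A (c • v) = c • actR A v := Matrix.mulVec_smul _ _ _

lemma actR_mem_lattice (A : Matrix (Fin 2) (Fin 2) ℤ) {v : V} (hv : v ∈ lattice) :
    actR A v ∈ lattice := by
  obtain ⟨m, rfl⟩ := hv
  refine ⟨A.mulVec m, ?_⟩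
  ext i
  simp [actR, Matrix.mulVec, dotProduct, Fin.sum_univ_two]

lemma iterate_sub_mem_lattice (A : Matrix (Fin 2) (Fin 2) ℤ) {v w : V}
    (h : v - w ∈ lattice) (t : ℕ) : (actR A)^[t] v - (actR A)^[t] w ∈ lattice := by
  induction t with
  | zero => simpa using h
  | succ t ih =>
    rw [Function.iterate_succ_apply', Function.iterate_succ_apply', ← actR_sub]
    exact actR_mem_lattice A ih

lemma iterate_add_mul_sub_mem_lattice (A : Matrix (Fin 2) (Fin 2) ℤ) {x : V} {p : ℕ}
    (h : (actR A)^[p] x - x ∈ lattice) (i k : ℕ) :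
    (actR A)^[i + p * k] x - (actR A)^[i] x ∈ lattice := by
  induction k with
  | zero => simpa using zero_mem_lattice
  | succ k ih =>
    have h1 := iterate_sub_mem_lattice A h (i + p * k)
    rw [← Function.iterate_add_apply] at h1
    have h2 := add_mem_lattice h1 ih
    rw [sub_add_sub_cancel] at h2
    rwa [mul_add_one, ← add_assoc]

lemma iterate_eigen {A : Matrix (Fin 2) (Fin 2) ℤ} {lam : ℝ} {vs vu : V}
    (hAs : actR A vs = lam⁻¹ • vs) (hAu : actR A vu = lam • vu) (a b : ℝ) (i : ℕ) :
    (actR A)^[i] (a • vs + b • vu) = (a * lam⁻¹ ^ i) • vs + (b * lam ^ i) • vu := by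
  induction i with
  | zero => simp
  | succ i ih =>
    rw [Function.iterate_succ_apply', ih, actR_add, actR_smul, actR_smul, hAs, hAu,
      smul_smul, smul_smul]
    ring_nf

/-! ### Eigencoordinates -/

lemma eigen_det_ne_zero {A : Matrix (Fin 2) (Fin 2) ℤ} {lam : ℝ} (hlam : 1 < lam) {vs vu : V}
    (hvs : vs ≠ 0) (hvu : vu ≠ 0) (hAs : actR A vs = lam⁻¹ • vs) (hAu : actR A vu = lam • vu) :
    vs 0 * vu 1 - vs 1 * vu 0 ≠ 0 := by
  intro h
  have hne : lam - lam⁻¹ ≠ 0 := by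
    have := inv_lt_one_of_one_lt₀ hlam
    linarith
  have key : ∀ c d : ℝ, c ≠ 0 → c • vu = d • vs → False := by
    intro c d hc hcd
    have h1 : actR A (c • vu) = lam⁻¹ • (c • vu) := by
      rw [hcd, actR_smul, hAs, smul_comm]
    rw [actR_smul, hAu, smul_comm c lam, ← sub_eq_zero, ← sub_smul, smul_smul] at h1
    exact (smul_ne_zero (mul_ne_zero hne hc) hvu) h1
  by_cases h0 : vs 0 = 0
  · have h1 : vs 1 ≠ 0 := fun h1 => hvs (by ext i; fin_cases i <;> simp [h0, h1])
    refine key (vs 1) (vu 1) h1 ?_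
    ext i; fin_cases i <;> simp <;> linarith
  · refine key (vs 0) (vu 0) h0 ?_
    ext i; fin_cases i <;> simp <;> linarith

lemma eq_zero_of_smul_add_smul_eq_zero {vs vu : V} (hD : vs 0 * vu 1 - vs 1 * vu 0 ≠ 0) {a b : ℝ}
    (h : a • vs + b • vu = 0) : a = 0 ∧ b = 0 := by
  have h0 : a * vs 0 + b * vu 0 = 0 := by simpa using congrFun h 0
  have h1 : a * vs 1 + b * vu 1 = 0 := by simpa using congrFun h 1
  constructor
  · refine (mul_eq_zero.mp (?_ : a * (vs 0 * vu 1 - vs 1 * vu 0) = 0)).resolve_right hD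
    linear_combination vu 1 * h0 - vu 0 * h1
  · refine (mul_eq_zero.mp (?_ : b * (vs 0 * vu 1 - vs 1 * vu 0) = 0)).resolve_right hD
    linear_combination vs 0 * h1 - vs 1 * h0

/-- Every point of the plane is within bounded eigencoordinate distance of the lattice. -/
lemma exists_near_lattice {vs vu : V} (hD : vs 0 * vu 1 - vs 1 * vu 0 ≠ 0) :
    ∃ C : ℝ, 0 ≤ C ∧ ∀ s t : ℝ, ∃ a b : ℝ,
      a • vs + b • vu ∈ lattice ∧ |a - s| ≤ C ∧ |b - t| ≤ C := by
  set D := vs 0 * vu 1 - vs 1 * vu 0 with hDdef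
  refine ⟨(|vs 0| + |vs 1| + |vu 0| + |vu 1|) / |D|, by positivity, fun s t => ?_⟩
  set f0 := Int.fract (s * vs 0 + t * vu 0) with hf0
  set f1 := Int.fract (s * vs 1 + t * vu 1) with hf1
  have b0 : |f0| ≤ 1 := by
    rw [abs_of_nonneg (Int.fract_nonneg _)]; exact (Int.fract_lt_one _).le
  have b1 : |f1| ≤ 1 := by
    rw [abs_of_nonneg (Int.fract_nonneg _)]; exact (Int.fract_lt_one _).le
  have e0 : (⌊s * vs 0 + t * vu 0⌋ : ℝ) = s * vs 0 + t * vu 0 - f0 := by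
    rw [hf0, Int.self_sub_fract]
  have e1 : (⌊s * vs 1 + t * vu 1⌋ : ℝ) = s * vs 1 + t * vu 1 - f1 := by
    rw [hf1, Int.self_sub_fract]
  have bound : ∀ p q : ℝ, |f0 * p - f1 * q| ≤ |p| + |q| := fun p q => by
    calc |f0 * p - f1 * q| ≤ |f0 * p| + |f1 * q| := abs_sub _ _
      _ = |f0| * |p| + |f1| * |q| := by rw [abs_mul, abs_mul]
      _ ≤ 1 * |p| + 1 * |q| := by gcongr
      _ = _ := by ring
  refine ⟨s - (f0 * vu 1 - f1 * vu 0) / D, t + (f0 * vs 1 - f1 * vs 0) / D,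
    ⟨![⌊s * vs 0 + t * vu 0⌋, ⌊s * vs 1 + t * vu 1⌋], ?_⟩, ?_, ?_⟩
  · ext i
    fin_cases i
    · simp only [Fin.zero_eta, Matrix.cons_val_zero, Pi.add_apply, Pi.smul_apply, smul_eq_mul, e0]
      field_simp
      rw [hDdef]; ring
    · simp only [Fin.mk_one, Matrix.cons_val_one, Matrix.cons_val_fin_one, Pi.add_apply,
        Pi.smul_apply, smul_eq_mul, e1]
      field_simp
      rw [hDdef]; ring
  · rw [sub_sub_cancel_left, abs_neg, abs_div]
    gcongr
    have := bound (vu 1) (vu 0)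
    linarith [abs_nonneg (vs 0), abs_nonneg (vs 1)]
  · rw [add_sub_cancel_left, abs_div]
    gcongr
    have := bound (vs 1) (vs 0)
    linarith [abs_nonneg (vu 0), abs_nonneg (vu 1)]

/-! ### The invariant quadratic form -/

lemma mul_sq_ne_sq {t x y : ℤ} (ht : 2 < t) (hy : y ≠ 0) : (t ^ 2 - 4) * y ^ 2 ≠ x ^ 2 := by
  intro h
  have hdvd : y ∣ x := (Int.pow_dvd_pow_iff two_ne_zero).mp ⟨t ^ 2 - 4, by linarith⟩
  obtain ⟨s, rfl⟩ := hdvd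
  have h2 : t ^ 2 - 4 = |s| ^ 2 := by
    rw [sq_abs]
    exact mul_right_cancel₀ (pow_ne_zero 2 hy) (by linarith)
  have h3 : |s| < t := by nlinarith [abs_nonneg s]
  have h4 : t - 1 < |s| := by nlinarith [abs_nonneg s]
  omega

/-- The form `m ↦ det (m, A m)` is anisotropic on the lattice. -/
lemma eq_zero_of_form_eq_zero {a b c d m n : ℤ} (hdet : a * d - b * c = 1) (htr : 2 < a + d)
    (h : m * (c * m + d * n) - n * (a * m + b * n) = 0) : m = 0 ∧ n = 0 := by
  have hdisc : (a + d) ^ 2 - 4 = (d - a) ^ 2 + 4 * (b * c) := by linear_combination 4 * hdet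
  by_cases hn : n = 0
  · subst hn
    refine ⟨?_, rfl⟩
    by_contra hm
    have hc : c = 0 := by
      have : c * m ^ 2 = 0 := by linear_combination h
      exact (mul_eq_zero.mp this).resolve_right (pow_ne_zero 2 hm)
    refine mul_sq_ne_sq (x := d - a) htr one_ne_zero ?_
    rw [hdisc, hc]; ring
  · refine (mul_sq_ne_sq (x := 2 * c * m + (d - a) * n) htr hn ?_).elim
    rw [hdisc]; linear_combination -4 * c * h

/-- Nonzero lattice points stay away from the union of the two eigenlines, uniformly
for the product of the eigencoordinates. -/
lemma exists_gap {A : Matrix (Fin 2) (Fin 2) ℤ} (hdet : A.det = 1) (htr : 2 < A.trace)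
    {lam : ℝ} (hlam : 1 < lam) {vs vu : V} (hD : vs 0 * vu 1 - vs 1 * vu 0 ≠ 0)
    (hAs : actR A vs = lam⁻¹ • vs) (hAu : actR A vu = lam • vu) :
    ∃ κ : ℝ, 0 < κ ∧ ∀ a b : ℝ, a • vs + b • vu ∈ lattice → |a| * |b| < κ → a = 0 ∧ b = 0 := by
  set D := vs 0 * vu 1 - vs 1 * vu 0 with hDdef
  have hpos : 0 < lam - lam⁻¹ := by
    have := inv_lt_one_of_one_lt₀ hlam
    linarith
  have hK : 0 < (lam - lam⁻¹) * |D| := by positivity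
  refine ⟨((lam - lam⁻¹) * |D|)⁻¹, inv_pos.mpr hK, fun a b ⟨m, hm⟩ hab => ?_⟩
  have hA : actR A (a • vs + b • vu) = (a * lam⁻¹) • vs + (b * lam) • vu :=
    by simpa using iterate_eigen hAs hAu a b 1
  have m0 : (m 0 : ℝ) = a * vs 0 + b * vu 0 := by simpa using congrFun hm 0
  have m1 : (m 1 : ℝ) = a * vs 1 + b * vu 1 := by simpa using congrFun hm 1
  have hA0 : (A 0 0 : ℝ) * m 0 + A 0 1 * m 1 = a * lam⁻¹ * vs 0 + b * lam * vu 0 := by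
    have := congrFun hA 0
    rw [← hm] at this
    simpa [actR, Matrix.mulVec, dotProduct, Fin.sum_univ_two] using this
  have hA1 : (A 1 0 : ℝ) * m 0 + A 1 1 * m 1 = a * lam⁻¹ * vs 1 + b * lam * vu 1 := by
    have := congrFun hA 1
    rw [← hm] at this
    simpa [actR, Matrix.mulVec, dotProduct, Fin.sum_univ_two] using this
  have hform : ((m 0 * (A 1 0 * m 0 + A 1 1 * m 1) - m 1 * (A 0 0 * m 0 + A 0 1 * m 1) : ℤ) : ℝ)
      = a * b * ((lam - lam⁻¹) * D) := by
    push_cast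
    rw [hA0, hA1, m0, m1, hDdef]
    ring
  have hlt : |((m 0 * (A 1 0 * m 0 + A 1 1 * m 1) -
      m 1 * (A 0 0 * m 0 + A 0 1 * m 1) : ℤ) : ℝ)| < 1 := by
    rw [hform, abs_mul, abs_mul, abs_mul, abs_of_pos hpos]
    calc _ < ((lam - lam⁻¹) * |D|)⁻¹ * ((lam - lam⁻¹) * |D|) := by gcongr
      _ = 1 := inv_mul_cancel₀ hK.ne'
  have hzero := Int.abs_lt_one_iff.mp (by exact_mod_cast hlt)
  rw [Matrix.det_fin_two] at hdet
  rw [Matrix.trace_fin_two] at htr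
  obtain ⟨h0, h1⟩ := eq_zero_of_form_eq_zero hdet htr hzero
  refine eq_zero_of_smul_add_smul_eq_zero hD ?_
  rw [← hm]
  ext i
  fin_cases i <;> simp [h0, h1]

/-! ### Periodic orbits along a hyperbola -/

/-- The lift of the forward orbit of the torus point represented by `x`. -/
def orbitLift (A : Matrix (Fin 2) (Fin 2) ℤ) (x : V) : Set V :=
  {v | ∃ i : ℕ, v - (actR A)^[i] x ∈ lattice}

lemma disjoint_orbitLift {A : Matrix (Fin 2) (Fin 2) ℤ} {x y : V} {p N : ℕ} (hp : 0 < p)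
    (hx : (actR A)^[p] x - x ∈ lattice) (h : (actR A)^[N] x ∉ orbitLift A y) :
    Disjoint (orbitLift A x) (orbitLift A y) := by
  rw [Set.disjoint_left]
  rintro v ⟨i, hi⟩ ⟨j, hj⟩
  obtain ⟨q, rfl⟩ : ∃ q, p = q + 1 := ⟨p - 1, by omega⟩
  have h1 := sub_mem_lattice hj hi
  rw [sub_sub_sub_cancel_left] at h1
  have h2 := iterate_sub_mem_lattice A h1 (N + q * i)
  rw [← Function.iterate_add_apply, ← Function.iterate_add_apply] at h2
  have h3 := iterate_add_mul_sub_mem_lattice A hx N i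
  rw [show N + (q + 1) * i = N + q * i + i by ring] at h3
  have h4 := sub_mem_lattice h2 h3
  rw [sub_sub_sub_cancel_left] at h4
  exact h ⟨N + q * i + j, by simpa using h4⟩

/-- The starting point of a periodic orbit of period `2 * N` whose `N`-th iterate has
eigencoordinates proportional to `(α, β)`. -/
noncomputable def hypPoint (lam : ℝ) (vs vu : V) (N : ℕ) (α β : ℝ) : V :=
  (α * (lam ^ N / ((lam ^ N) ^ 2 - 1)) * lam ^ N) • vs +
    (β * (lam ^ N / ((lam ^ N) ^ 2 - 1)) * (lam ^ N)⁻¹) • vu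

section Hyperbola

variable {A : Matrix (Fin 2) (Fin 2) ℤ} {lam : ℝ} {vs vu : V} {N : ℕ} {α β : ℝ}

lemma hypPoint_periodic (hAs : actR A vs = lam⁻¹ • vs) (hAu : actR A vu = lam • vu)
    (hT : 1 < lam ^ N) (h : (-α) • vs + β • vu ∈ lattice) :
    (actR A)^[2 * N] (hypPoint lam vs vu N α β) - hypPoint lam vs vu N α β ∈ lattice := by
  have hT0 : lam ^ N ≠ 0 := by positivity
  have hne : (lam ^ N) ^ 2 - 1 ≠ 0 := by nlinarith
  rw [hypPoint, iterate_eigen hAs hAu, inv_pow, mul_comm 2 N, pow_mul]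
  convert h using 1
  rw [add_sub_add_comm, ← sub_smul, ← sub_smul]
  congr 2
  · field_simp
    ring
  · field_simp

lemma hypPoint_iterate_mid (hlam : 1 < lam) (hAs : actR A vs = lam⁻¹ • vs)
    (hAu : actR A vu = lam • vu) :
    (actR A)^[N] (hypPoint lam vs vu N α β) =
      (α * (lam ^ N / ((lam ^ N) ^ 2 - 1))) • vs +
        (β * (lam ^ N / ((lam ^ N) ^ 2 - 1))) • vu := by
  have hT0 : lam ^ N ≠ 0 := by positivity
  rw [hypPoint, iterate_eigen hAs hAu, inv_pow, mul_assoc, mul_assoc _ (lam ^ N)⁻¹,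
    mul_inv_cancel₀ hT0, inv_mul_cancel₀ hT0, mul_one, mul_one]

lemma hypPoint_iterate_mid_succ (hlam : 1 < lam) (hAs : actR A vs = lam⁻¹ • vs)
    (hAu : actR A vu = lam • vu) :
    (actR A)^[N + 1] (hypPoint lam vs vu N α β) =
      (α * (lam ^ N / ((lam ^ N) ^ 2 - 1)) * lam⁻¹) • vs +
        (β * (lam ^ N / ((lam ^ N) ^ 2 - 1)) * lam) • vu := by
  rw [Function.iterate_succ_apply', hypPoint_iterate_mid hlam hAs hAu, actR_add, actR_smul,
    actR_smul, hAs, hAu, smul_smul, smul_smul]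

/-- Points near the origin and outside the quadrant of `(α, β)` are not on the orbit. -/
lemma notMem_orbitLift_hypPoint (hlam : 1 < lam) (hAs : actR A vs = lam⁻¹ • vs)
    (hAu : actR A vu = lam • vu) {κ M : ℝ} (hM : 0 < M)
    (hκ : ∀ a b : ℝ, a • vs + b • vu ∈ lattice → |a| * |b| < κ → a = 0 ∧ b = 0)
    (hT : 2 ≤ lam ^ N) (hTκ : lam ^ N / ((lam ^ N) ^ 2 - 1) * (6 * lam ^ 2 * M ^ 2) < κ)
    (h : (-α) • vs + β • vu ∈ lattice) (hα : |α| ≤ M) (hβ : |β| ≤ M) {r t : ℝ}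
    (hr : |r| ≤ lam ^ N / ((lam ^ N) ^ 2 - 1) * (lam * M))
    (ht : |t| ≤ lam ^ N / ((lam ^ N) ^ 2 - 1) * (lam * M)) (hrα : r * α < 0) :
    r • vs + t • vu ∉ orbitLift A (hypPoint lam vs vu N α β) := by
  rintro ⟨i, hi⟩
  have hper := hypPoint_periodic hAs hAu (by linarith) h
  have hN : 0 < 2 * N := by
    rcases Nat.eq_zero_or_pos N with rfl | h0
    · norm_num at hT
    · omega
  obtain ⟨j, hj, hj'⟩ : ∃ j < 2 * N, r • vs + t • vu -
      (actR A)^[j] (hypPoint lam vs vu N α β) ∈ lattice := by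
    refine ⟨i % (2 * N), Nat.mod_lt _ hN, ?_⟩
    have h1 := iterate_add_mul_sub_mem_lattice A hper (i % (2 * N)) (i / (2 * N))
    rw [Nat.mod_add_div] at h1
    simpa using add_mem_lattice hi h1
  set T := lam ^ N with hTdef
  set ε := T / (T ^ 2 - 1) with hε
  have hden : 0 < T ^ 2 - 1 := by nlinarith
  have hε0 : 0 < ε := by positivity
  have hε1 : ε ≤ 1 := by rw [hε, div_le_one hden]; nlinarith
  have hεT : ε * T ≤ 2 := by rw [hε, div_mul_eq_mul_div, div_le_iff₀ hden]; nlinarith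
  have hlam0 : 0 < lam := by linarith
  rw [hypPoint, iterate_eigen hAs hAu, add_sub_add_comm, ← sub_smul, ← sub_smul,
    ← hTdef, ← hε] at hj'
  have hMlam : M ≤ lam * M := le_mul_of_one_le_left hM.le hlam.le
  have small : ∀ z γ c : ℝ, |z| ≤ ε * (lam * M) → |γ| ≤ M → 0 ≤ c → c ≤ 1 →
      |z - γ * ε * c| ≤ 2 * ε * (lam * M) := fun z γ c hz hγ hc0 hc1 => by
    have : |γ * ε * c| ≤ M * ε * 1 := by
      rw [abs_mul, abs_mul, abs_of_pos hε0, abs_of_nonneg hc0]; gcongr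
    have h3 := abs_sub z (γ * ε * c)
    nlinarith
  have large : ∀ z γ c : ℝ, |z| ≤ ε * (lam * M) → |γ| ≤ M → 0 ≤ c → c ≤ T →
      |z - γ * ε * c| ≤ 3 * (lam * M) := fun z γ c hz hγ hc0 hc1 => by
    have : |γ * ε * c| ≤ M * (ε * T) := by
      rw [abs_mul, abs_mul, abs_of_pos hε0, abs_of_nonneg hc0, mul_assoc]; gcongr
    have h3 := abs_sub z (γ * ε * c)
    nlinarith
  have hzero := hκ _ _ hj' (by
    refine lt_of_le_of_lt ?_ hTκ
    rw [mul_assoc (α * ε), mul_assoc (β * ε)]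
    rcases le_total j N with hjN | hjN
    · have h1 := large r α (T * lam⁻¹ ^ j) hr hα (by positivity)
        (mul_le_of_le_one_right (by positivity)
          (pow_le_one₀ (by positivity) (inv_le_one_of_one_le₀ hlam.le)))
      have h2 := small t β (T⁻¹ * lam ^ j) ht hβ (by positivity) (by
        rw [inv_mul_le_one₀ (by positivity)]
        exact pow_le_pow_right₀ hlam.le hjN)
      calc _ ≤ (3 * (lam * M)) * (2 * ε * (lam * M)) := by gcongr
        _ = _ := by ring
    · have h1 := small r α (T * lam⁻¹ ^ j) hr hα (by positivity) (by
        rw [inv_pow, mul_comm, inv_mul_le_one₀ (by positivity)]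
        exact pow_le_pow_right₀ hlam.le hjN)
      have h2 := large t β (T⁻¹ * lam ^ j) ht hβ (by positivity) (by
        rw [inv_mul_le_iff₀ (by positivity), hTdef, ← pow_add]
        exact pow_le_pow_right₀ hlam.le (by omega))
      calc _ ≤ (2 * ε * (lam * M)) * (3 * (lam * M)) := by gcongr
        _ = _ := by ring)
  have hreq : r = α * ε * T * lam⁻¹ ^ j := by linarith [hzero.1]
  have : 0 ≤ r * α := by
    rw [hreq, show α * ε * T * lam⁻¹ ^ j * α = α ^ 2 * (ε * T * lam⁻¹ ^ j) by ring]
    positivity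
  linarith

end Hyperbola

/-- Let `A ∈ SL(2,ℤ)` with trace `> 2`. Then there exist two
disjoint periodic orbits `𝒳` and `𝒴` of `f_A` such that there exists a positive
`𝒳`-rectangle disjoint from `𝒴̃` and a negative `𝒴`-rectangle disjoint from `𝒳̃`. -/
theorem statement_0 (A : Matrix (Fin 2) (Fin 2) ℤ) (hdet : A.det = 1) (htr : 2 < A.trace)
    (lam : ℝ) (hlam : 1 < lam) (vs vu : V) (hvs : vs ≠ 0) (hvu : vu ≠ 0)
    (hAs : actR A vs = lam⁻¹ • vs) (hAu : actR A vu = lam • vu) :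
    ∃ X Y : Set V, IsPeriodicOrbit A X ∧ IsPeriodicOrbit A Y ∧ Disjoint X Y ∧
      (∃ R : Rect, R.IsPos vs vu X ∧ Disjoint (R.carrier vs vu) Y) ∧
      (∃ R : Rect, R.IsNeg vs vu Y ∧ Disjoint (R.carrier vs vu) X) := by
  have hD := eigen_det_ne_zero hlam hvs hvu hAs hAu
  obtain ⟨κ, hκ0, hκ⟩ := exists_gap hdet htr hlam hD hAs hAu
  obtain ⟨C, hC, hnear⟩ := exists_near_lattice hD
  obtain ⟨a, b, hab, ha, hb⟩ := hnear (C + 1) (C + 1)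
  obtain ⟨c, d, hcd, hc, hd⟩ := hnear (-(C + 1)) (C + 1)
  rw [abs_le] at ha hb hc hd
  obtain ⟨α, rfl⟩ : ∃ α, c = -α := ⟨-c, (neg_neg c).symm⟩
  have hlam0 : 0 < lam := by linarith
  set M := 2 * C + 1 with hMdef
  have hM : 0 < M := by positivity
  have hK : 0 < 6 * lam ^ 2 * M ^ 2 := by positivity
  obtain ⟨N, hN⟩ := pow_unbounded_of_one_lt (2 + 2 * (6 * lam ^ 2 * M ^ 2) / κ) hlam
  have hq : 0 < 2 * (6 * lam ^ 2 * M ^ 2) / κ := by positivity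
  have hT : 2 ≤ lam ^ N := by linarith
  have hTK : 2 * (6 * lam ^ 2 * M ^ 2) < lam ^ N * κ := by
    rw [← div_lt_iff₀ hκ0]; linarith
  have hden : 0 < (lam ^ N) ^ 2 - 1 := by nlinarith
  have hTκ : lam ^ N / ((lam ^ N) ^ 2 - 1) * (6 * lam ^ 2 * M ^ 2) < κ := by
    rw [div_mul_eq_mul_div, div_lt_iff₀ hden]
    nlinarith [mul_lt_mul_of_pos_left hTK (by linarith : 0 < lam ^ N)]
  have hNpos : 0 < 2 * N := by
    rcases Nat.eq_zero_or_pos N with rfl | h0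
    · norm_num at hT
    · omega
  have hab' : (-(-a)) • vs + b • vu ∈ lattice := by rwa [neg_neg]
  have avoidX : ∀ r t : ℝ, _ → _ → _ → _ := fun r t hr ht hs =>
    notMem_orbitLift_hypPoint (r := r) (t := t) hlam hAs hAu hM hκ hT hTκ hab'
      (abs_le.mpr ⟨by linarith, by linarith⟩) (abs_le.mpr ⟨by linarith, by linarith⟩) hr ht hs
  have avoidY : ∀ r t : ℝ, _ → _ → _ → _ := fun r t hr ht hs =>
    notMem_orbitLift_hypPoint (r := r) (t := t) hlam hAs hAu hM hκ hT hTκ hcd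
      (abs_le.mpr ⟨by linarith, by linarith⟩) (abs_le.mpr ⟨by linarith, by linarith⟩) hr ht hs
  have perX := hypPoint_periodic hAs hAu (by linarith : 1 < lam ^ N) hab'
  have perY := hypPoint_periodic hAs hAu (by linarith : 1 < lam ^ N) hcd
  have midX := hypPoint_iterate_mid (N := N) (α := -a) (β := b) hlam hAs hAu
  have midY := hypPoint_iterate_mid (N := N) (α := α) (β := d) hlam hAs hAu
  have succX := hypPoint_iterate_mid_succ (N := N) (α := -a) (β := b) hlam hAs hAu
  have succY := hypPoint_iterate_mid_succ (N := N) (α := α) (β := d) hlam hAs hAu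
  set ε := lam ^ N / ((lam ^ N) ^ 2 - 1)
  have hε0 : 0 < ε := div_pos (by linarith) hden
  have ha0 : 0 < a := by linarith
  have hb0 : 0 < b := by linarith
  have hα0 : 0 < α := by linarith
  have hd0 : 0 < d := by linarith
  have hinv : 0 < 1 - lam⁻¹ := by
    have := inv_lt_one_of_one_lt₀ hlam
    linarith
  have hlam1 : 0 < lam - 1 := by linarith
  have hil : 0 < lam⁻¹ := by positivity
  have le_bound : ∀ γ μ : ℝ, 0 < γ → γ ≤ M → 0 ≤ μ → μ ≤ lam → γ * ε * μ ≤ ε * (lam * M) :=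
    fun γ μ h0 h1 h2 h3 => by
      calc γ * ε * μ ≤ M * ε * lam := by gcongr
        _ = _ := by ring
  have neg_bound : 0 ≤ ε * (lam * M) := by positivity
  have ba := le_bound a 1 ha0 (by linarith) zero_le_one hlam.le
  have bα := le_bound α 1 hα0 (by linarith) zero_le_one hlam.le
  have bb := le_bound b lam hb0 (by linarith) hlam0.le le_rfl
  have bd := le_bound d lam hd0 (by linarith) hlam0.le le_rfl
  have hpb : 0 < b * ε := by positivity
  have hpd : 0 < d * ε := by positivity
  have hpa : 0 < a * ε * lam⁻¹ := by positivity
  have hpα : 0 < α * ε * lam⁻¹ := by positivity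
  have avoidYX : ∀ r t : ℝ, -(a * ε) ≤ r → r ≤ -(a * ε * lam⁻¹) → b * ε ≤ t →
      t ≤ b * ε * lam → r • vs + t • vu ∉ orbitLift A (hypPoint lam vs vu N α d) :=
    fun r t h1 h2 h3 h4 => avoidY r t (abs_le.mpr ⟨by linarith, by linarith⟩)
      (abs_le.mpr ⟨by linarith, by linarith⟩) (mul_neg_of_neg_of_pos (by linarith) hα0)
  have avoidXY : ∀ r t : ℝ, α * ε * lam⁻¹ ≤ r → r ≤ α * ε → d * ε ≤ t →
      t ≤ d * ε * lam → r • vs + t • vu ∉ orbitLift A (hypPoint lam vs vu N (-a) b) :=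
    fun r t h1 h2 h3 h4 => avoidX r t (abs_le.mpr ⟨by linarith, by linarith⟩)
      (abs_le.mpr ⟨by linarith, by linarith⟩) (mul_neg_of_pos_of_neg (by linarith) (by linarith))
  refine ⟨orbitLift A (hypPoint lam vs vu N (-a) b), orbitLift A (hypPoint lam vs vu N α d),
    ⟨_, _, hNpos, perX, rfl⟩, ⟨_, _, hNpos, perY, rfl⟩, ?_, ?_, ?_⟩
  · refine disjoint_orbitLift (N := N) hNpos perX ?_
    rw [midX]
    exact avoidYX _ _ (by linarith) (by nlinarith) le_rfl (by nlinarith)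
  · refine ⟨⟨(-a * ε) • vs + (b * ε) • vu, a * ε * (1 - lam⁻¹), b * ε * (lam - 1),
      by positivity, by positivity⟩, ⟨⟨N, ?_⟩, ⟨N + 1, ?_⟩⟩, ?_⟩
    · simpa [midX] using zero_mem_lattice
    · rw [succX]
      convert zero_mem_lattice using 1
      simp only [Rect.incEnd]
      module
    · rw [Set.disjoint_left]
      rintro q ⟨x, y, hx0, hx1, hy0, hy1, rfl⟩
      dsimp only at hx1 hy1
      have := avoidYX (-a * ε + x) (b * ε + y) (by linarith) (by linarith) (by linarith)
        (by linarith)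
      convert this using 2
      module
  · refine ⟨⟨(α * ε * lam⁻¹) • vs + (d * ε) • vu, α * ε * (1 - lam⁻¹), d * ε * (lam - 1),
      by positivity, by positivity⟩, ⟨⟨N, ?_⟩, ⟨N + 1, ?_⟩⟩, ?_⟩
    · rw [midY]
      convert zero_mem_lattice using 1
      simp only [Rect.decOrigin]
      module
    · rw [succY]
      convert zero_mem_lattice using 1
      simp only [Rect.decEnd]
      module
    · rw [Set.disjoint_left]
      rintro q ⟨x, y, hx0, hx1, hy0, hy1, rfl⟩
      dsimp only at hx1 hy1
      have := avoidXY (α * ε * lam⁻¹ + x) (d * ε + y) (by linarith) (by linarith) (by linarith)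
        (by linarith)
      convert this using 2
      module

end Paper
end

section
/- Let A be a 2×2 integer matrix with determinant 1 and trace > 2, and let 𝒳, 𝒴 ⊆ 𝕋² be disjoint finite f_A-invariant sets with 𝒴 nonempty. If there exists a positive 𝒳-string with origin x ∈ 𝒳̃ all of whose rectangles are disjoint from the lift 𝒴̃, then there exists a positive 𝒳-staircase with origin x all of whose rectangles are disjoint from 𝒴̃. -/
/- Common setup: following the paper, we identify each subset of the torus
`𝕋² = ℝ²/ℤ²` with its (`ℤ²`-saturated) lift to `ℝ²`. -/

open Matrix Set
open scoped Pointwise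

namespace Paper

/-- The hyperbolic linear map `(a, b) ↦ (t a, t⁻¹ b)`. -/
noncomputable def hyp (t : ℝ) (q : ℝ × ℝ) : ℝ × ℝ := (t * q.1, t⁻¹ * q.2)

lemma hyp_hyp (s t : ℝ) (q : ℝ × ℝ) : hyp s (hyp t q) = hyp (s * t) q := by
  simp [hyp, mul_comm, mul_left_comm]

lemma hyp_add (t : ℝ) (q r : ℝ × ℝ) : hyp t (q + r) = hyp t q + hyp t r := by
  simp [hyp, mul_add]

lemma hyp_sub (t : ℝ) (q r : ℝ × ℝ) : hyp t (q - r) = hyp t q - hyp t r := by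
  simp [hyp, mul_sub]

lemma hyp_one (q : ℝ × ℝ) : hyp 1 q = q := by simp [hyp]

/-- Every bounded box contains finitely many points of `D`. -/
def BoxFinite (D : Set (ℝ × ℝ)) : Prop :=
  ∀ r : ℝ, (D ∩ {q | |q.1| ≤ r ∧ |q.2| ≤ r}).Finite

/-- Invariance under all the integer powers of `hyp lam`. -/
def HypInvariant (lam : ℝ) (D : Set (ℝ × ℝ)) : Prop :=
  ∀ n : ℤ, ∀ q ∈ D, hyp (lam ^ n) q ∈ D

lemma hypInvariant_of_one {lam : ℝ} (hlam : 1 < lam) {D : Set (ℝ × ℝ)}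
    (h1 : ∀ q ∈ D, hyp lam q ∈ D) (h2 : ∀ q ∈ D, hyp lam⁻¹ q ∈ D) : HypInvariant lam D := by
  have h0 : lam ≠ 0 := by positivity
  intro n
  induction n using Int.induction_on with
  | zero => intro q hq; simpa [hyp_one] using hq
  | succ n ih =>
    intro q hq
    have := ih _ (h1 q hq)
    rwa [hyp_hyp, ← zpow_add_one₀ h0] at this
  | pred n ih =>
    intro q hq
    have := ih _ (h2 q hq)
    rwa [hyp_hyp, ← zpow_sub_one₀ h0] at this

lemma exists_le_abs_mul {lam : ℝ} (hlam : 1 < lam) {D : Set (ℝ × ℝ)}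
    (hD : HypInvariant lam D) (hfin : BoxFinite D) :
    ∃ κ > 0, ∀ q ∈ D, q.1 ≠ 0 → q.2 ≠ 0 → κ ≤ |q.1 * q.2| := by
  have hfin' := ((hfin lam).subset (inter_subset_inter_left _
    (sep_subset D fun q => q.1 * q.2 ≠ 0))).image fun q => |q.1 * q.2|
  obtain ⟨κ, hκ, hmin⟩ : ∃ κ > 0, ∀ q ∈ D, q.1 * q.2 ≠ 0 → |q.1| ≤ lam → |q.2| ≤ lam →
      κ ≤ |q.1 * q.2| := by
    rcases (((fun q : ℝ × ℝ => |q.1 * q.2|) '' ({q ∈ D | q.1 * q.2 ≠ 0} ∩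
      {q | |q.1| ≤ lam ∧ |q.2| ≤ lam})).eq_empty_or_nonempty) with he | hne
    · refine ⟨1, one_pos, fun q hq h0 h1 h2 => ?_⟩
      have : |q.1 * q.2| ∈ ((fun q : ℝ × ℝ => |q.1 * q.2|) '' ({q ∈ D | q.1 * q.2 ≠ 0} ∩
        {q | |q.1| ≤ lam ∧ |q.2| ≤ lam})) := ⟨q, ⟨⟨hq, h0⟩, h1, h2⟩, rfl⟩
      rw [he] at this
      exact this.elim
    · obtain ⟨κ, ⟨q, ⟨⟨hq, h0⟩, -⟩, rfl⟩, hm⟩ := hfin'.exists_minimal hne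
      refine ⟨|q.1 * q.2|, abs_pos.2 h0, fun r hr h0 h1 h2 => ?_⟩
      have hr' : |r.1 * r.2| ∈ ((fun q : ℝ × ℝ => |q.1 * q.2|) '' ({q ∈ D | q.1 * q.2 ≠ 0} ∩
        {q | |q.1| ≤ lam ∧ |q.2| ≤ lam})) := ⟨r, ⟨⟨hr, h0⟩, h1, h2⟩, rfl⟩
      rcases le_total |r.1 * r.2| |q.1 * q.2| with h | h
      · exact hm hr' h
      · exact h
  refine ⟨min κ 1, by positivity, fun q hq h1 h2 => ?_⟩
  by_contra! hlt
  obtain ⟨n, hn1, hn2⟩ := exists_mem_Ico_zpow (abs_pos.2 h1) hlam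
  have hpos : 0 < lam ^ n := by positivity
  have hposn : 0 < lam ^ (-n) := by positivity
  have hmul : lam ^ (-n) * lam ^ n = 1 := by
    rw [_root_.zpow_neg]; field_simp
  have e1 : |(hyp (lam ^ (-n)) q).1| = lam ^ (-n) * |q.1| := by
    simp only [hyp, abs_mul, abs_of_pos hposn]
  have e2 : |(hyp (lam ^ (-n)) q).2| = lam ^ n * |q.2| := by
    simp only [hyp, abs_mul]
    rw [_root_.zpow_neg, inv_inv, abs_of_pos hpos]
  have e3 : (hyp (lam ^ (-n)) q).1 * (hyp (lam ^ (-n)) q).2 = q.1 * q.2 := by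
    simp only [hyp]; field_simp
  rw [abs_mul] at hlt
  have := hmin _ (hD (-n) q hq) (by rw [e3]; exact mul_ne_zero h1 h2)
    (by
      rw [e1]
      calc lam ^ (-n) * |q.1| ≤ lam ^ (-n) * lam ^ (n + 1) := by gcongr
        _ = lam := by rw [zpow_add_one₀ (by positivity), ← mul_assoc, hmul, one_mul])
    (by
      rw [e2]
      calc lam ^ n * |q.2| ≤ |q.1| * |q.2| := by gcongr
        _ ≤ 1 := (hlt.trans_le (min_le_right _ _)).le
        _ ≤ lam := hlam.le)
  rw [e3, abs_mul] at this
  exact absurd (hlt.trans_le (min_le_left _ _)) (not_lt.2 this)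

lemma eq_zero_of_mem_axis {lam : ℝ} (hlam : 1 < lam) {D : Set (ℝ × ℝ)}
    (hD : HypInvariant lam D) (hfin : BoxFinite D) {q : ℝ × ℝ} (hq : q ∈ D)
    (h0 : q.1 = 0 ∨ q.2 = 0) : q = 0 := by
  have hl0 : (0 : ℝ) < lam := by positivity
  have key : ∀ v : ℝ, ∀ n : ℕ, |(lam ^ n)⁻¹ * v| ≤ |v| := by
    intro v n
    rw [abs_mul, abs_of_pos (by positivity)]
    exact mul_le_of_le_one_left (abs_nonneg _) (inv_le_one_of_one_le₀ (one_le_pow₀ hlam.le))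
  have hinj : ∀ v : ℝ, v ≠ 0 → ∀ m n : ℕ, (lam ^ m)⁻¹ * v = (lam ^ n)⁻¹ * v → m = n := by
    intro v hv m n h
    exact pow_right_injective₀ hl0 hlam.ne' (inv_injective (mul_right_cancel₀ hv h))
  rcases h0 with h0 | h0
  · by_contra hne
    have h2 : q.2 ≠ 0 := fun h => hne (Prod.ext h0 h)
    have hmap : ∀ n : ℕ, hyp (lam ^ (n : ℤ)) q ∈ D ∩ {r | |r.1| ≤ |q.2| ∧ |r.2| ≤ |q.2|} := by
      intro n
      refine ⟨hD _ _ hq, ?_, ?_⟩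
      · simp [hyp, h0]
      · simpa [hyp] using key q.2 n
    refine Set.infinite_of_injective_forall_mem (fun m n h => hinj q.2 h2 m n ?_) hmap
      (hfin |q.2|)
    simpa [hyp] using congrArg Prod.snd h
  · by_contra hne
    have h1 : q.1 ≠ 0 := fun h => hne (Prod.ext h h0)
    have hmap : ∀ n : ℕ, hyp (lam ^ (-(n : ℤ))) q ∈
        D ∩ {r | |r.1| ≤ |q.1| ∧ |r.2| ≤ |q.1|} := by
      intro n
      refine ⟨hD _ _ hq, ?_, ?_⟩
      · simpa [hyp] using key q.1 n
      · simp [hyp, h0]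
    refine Set.infinite_of_injective_forall_mem (fun m n h => hinj q.1 h1 m n ?_) hmap
      (hfin |q.1|)
    simpa [hyp] using congrArg Prod.fst h

lemma exists_area_le {lam : ℝ} (hlam : 1 < lam) {Y : Set (ℝ × ℝ)} (hY : HypInvariant lam Y)
    {r : ℝ} (hr : 0 < r) (hdense : ∀ q : ℝ × ℝ, ∃ y ∈ Y, y ∈ Icc q (q + (r, r))) :
    ∃ K, ∀ a b : ℝ × ℝ, a.1 < b.1 → a.2 < b.2 → Disjoint (Icc a b) Y →
      (b.1 - a.1) * (b.2 - a.2) ≤ K := by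
  refine ⟨r * r * lam, fun a b h1 h2 hdisj => ?_⟩
  by_contra! hlt
  have hs : 0 < b.1 - a.1 := sub_pos.2 h1
  have hu : 0 < b.2 - a.2 := sub_pos.2 h2
  obtain ⟨n, hn1, hn2⟩ := exists_mem_Ico_zpow (div_pos hs hr) hlam
  have hpos : 0 < lam ^ n := by positivity
  rw [le_div_iff₀ hr] at hn1
  rw [zpow_add_one₀ (by positivity), div_lt_iff₀ hr] at hn2
  obtain ⟨y, hy, hy1, hy2⟩ := hdense (hyp (lam ^ (-n)) a)
  have hy' := hY n y hy
  refine Set.disjoint_left.1 hdisj ?_ hy'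
  have hu' : r ≤ lam ^ n * (b.2 - a.2) := by
    by_contra! h
    have : (b.1 - a.1) * (b.2 - a.2) < lam ^ n * lam * r * (b.2 - a.2) := by gcongr
    nlinarith [mul_pos hr (zero_lt_one.trans hlam)]
  obtain ⟨hy11, hy12⟩ := hy1
  obtain ⟨hy21, hy22⟩ := hy2
  simp only [hyp, _root_.zpow_neg, inv_inv, Prod.fst_add, Prod.snd_add] at hy11 hy12 hy21 hy22
  rw [inv_mul_le_iff₀ hpos] at hy11
  have e1 : lam ^ n * y.1 ≤ a.1 + lam ^ n * r := by
    calc lam ^ n * y.1 ≤ lam ^ n * ((lam ^ n)⁻¹ * a.1 + r) := by gcongr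
      _ = a.1 + lam ^ n * r := by field_simp
  refine ⟨⟨hy11, ?_⟩, ⟨?_, ?_⟩⟩
  · simp only [hyp]
    rw [le_inv_mul_iff₀ hpos]; exact hy12
  · simp only [hyp]; linarith
  · simp only [hyp]
    rw [inv_mul_le_iff₀ hpos]; linarith

lemma exists_period {lam : ℝ} (hlam : 1 < lam) {X F : Set (ℝ × ℝ)} {L : AddSubgroup (ℝ × ℝ)}
    (hX : HypInvariant lam X) (hL : ∀ l ∈ L, hyp lam⁻¹ l ∈ L) (hF : F.Finite)
    (hXF : X = F + (L : Set (ℝ × ℝ))) :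
    ∃ p : ℕ, 0 < p ∧ ∀ k : ℤ, ∀ z ∈ X, hyp ((lam ^ p) ^ k) z - z ∈ L := by
  have h0 : lam ≠ 0 := by positivity
  have hLn : ∀ n : ℕ, ∀ l ∈ L, hyp (lam⁻¹ ^ n) l ∈ L := by
    intro n
    induction n with
    | zero => intro l hl; simpa [hyp_one] using hl
    | succ n ih =>
      intro l hl
      have := ih _ (hL l hl)
      rwa [hyp_hyp, ← pow_succ] at this
  have hFX : F ⊆ X := fun f hf => by
    rw [hXF]; exact ⟨f, hf, 0, L.zero_mem, by simp⟩
  have hrep : ∀ n : ℕ, ∀ f : F, ∃ g : F, hyp (lam ^ n) f - g ∈ L := by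
    intro n f
    have := hX n f (hFX f.2)
    rw [hXF] at this
    obtain ⟨g, hg, l, hl, h⟩ := this
    refine ⟨⟨g, hg⟩, ?_⟩
    rw [zpow_natCast] at h
    simpa [← h] using hl
  choose rep hrep using hrep
  have : Finite F := hF
  obtain ⟨n, m, hnm, heq⟩ : ∃ n m : ℕ, n < m ∧ rep n = rep m := by
    obtain ⟨n, m, hne, h⟩ := Finite.exists_ne_map_eq_of_infinite rep
    rcases lt_or_gt_of_ne hne with hlt | hlt
    · exact ⟨n, m, hlt, h⟩
    · exact ⟨m, n, hlt, h.symm⟩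
  have hper : ∀ z ∈ X, hyp (lam⁻¹ ^ (m - n)) z - z ∈ L := by
    intro z hz
    rw [hXF] at hz
    obtain ⟨f, hf, l, hl, rfl⟩ := hz
    have h1 : hyp (lam ^ n) f - hyp (lam ^ m) f ∈ L := by
      have := L.sub_mem (hrep n ⟨f, hf⟩) (hrep m ⟨f, hf⟩)
      rw [heq] at this
      simpa using this
    have h2 := hLn m _ h1
    rw [hyp_sub, hyp_hyp, hyp_hyp] at h2
    have e1 : lam⁻¹ ^ m * lam ^ m = 1 := by rw [← mul_pow, inv_mul_cancel₀ h0, one_pow]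
    have e2 : lam⁻¹ ^ m * lam ^ n = lam⁻¹ ^ (m - n) := by
      obtain ⟨d, rfl⟩ := Nat.exists_eq_add_of_le hnm.le
      rw [Nat.add_sub_cancel_left, pow_add, mul_right_comm, ← mul_pow, inv_mul_cancel₀ h0,
        one_pow, one_mul]
    rw [e1, e2, hyp_one] at h2
    have h3 := L.add_mem h2 (L.sub_mem (hLn (m - n) l hl) hl)
    convert h3 using 1
    simp only [hyp_add]
    abel
  refine ⟨m - n, Nat.sub_pos_of_lt hnm, ?_⟩
  set p := m - n
  have hXp : ∀ k : ℤ, ∀ z ∈ X, hyp ((lam ^ p) ^ k) z ∈ X := by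
    intro k z hz
    have := hX (p * k) z hz
    rwa [_root_.zpow_mul, zpow_natCast] at this
  have hp0 : lam ^ p ≠ 0 := pow_ne_zero _ h0
  intro k
  induction k using Int.induction_on with
  | zero => intro z _; simp [hyp_one]
  | succ k ih =>
    intro z hz
    have hz' := hXp (k + 1) z hz
    have h1 := hper _ hz'
    rw [hyp_hyp, inv_pow, zpow_add_one₀ hp0, mul_comm _ (lam ^ p), inv_mul_cancel_left₀ hp0] at h1
    have := L.sub_mem (ih z hz) h1
    rw [zpow_add_one₀ hp0, mul_comm _ (lam ^ p)]
    simpa using this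
  | pred k ih =>
    intro z hz
    have h1 := hper _ (hXp (-k) z hz)
    rw [hyp_hyp, inv_pow, mul_comm, ← zpow_sub_one₀ hp0] at h1
    have := L.add_mem h1 (ih z hz)
    simpa using this

/-- `z` is the origin of an increasing sequence of points of `X` such that the rectangles spanned
by consecutive points are disjoint from `Y`. -/
def IsChainOrigin (X Y : Set (ℝ × ℝ)) (z : ℝ × ℝ) : Prop :=
  ∃ w : ℕ → ℝ × ℝ, w 0 = z ∧ ∀ i, w i ∈ X ∧ (w i).1 < (w (i + 1)).1 ∧
    (w i).2 < (w (i + 1)).2 ∧ Disjoint (Icc (w i) (w (i + 1))) Y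

lemma IsChainOrigin.mem {X Y : Set (ℝ × ℝ)} {z : ℝ × ℝ} (h : IsChainOrigin X Y z) : z ∈ X := by
  obtain ⟨w, rfl, h⟩ := h
  exact (h 0).1

lemma IsChainOrigin.exists_next {X Y : Set (ℝ × ℝ)} {z : ℝ × ℝ} (h : IsChainOrigin X Y z) :
    ∃ z', IsChainOrigin X Y z' ∧ z.1 < z'.1 ∧ z.2 < z'.2 ∧ Disjoint (Icc z z') Y := by
  obtain ⟨w, rfl, h⟩ := h
  exact ⟨w 1, ⟨fun i => w (i + 1), rfl, fun i => h (i + 1)⟩, (h 0).2⟩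

/-- `hyp t` recentred at `z`. -/
noncomputable def hypAt (z : ℝ × ℝ) (t : ℝ) (q : ℝ × ℝ) : ℝ × ℝ := z + hyp t (q - z)

lemma hypAt_hypAt_inv (z : ℝ × ℝ) {t : ℝ} (ht : t ≠ 0) (q : ℝ × ℝ) :
    hypAt z t⁻¹ (hypAt z t q) = q := by
  simp [hypAt, hyp_hyp, inv_mul_cancel₀ ht, hyp_one]

lemma hypAt_mono (z : ℝ × ℝ) {t : ℝ} (ht : 0 < t) {q r : ℝ × ℝ} (h : q ≤ r) :
    hypAt z t q ≤ hypAt z t r := by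
  have h1 := h.1
  have h2 := h.2
  constructor <;> simp only [hypAt, hyp, Prod.fst_add, Prod.snd_add, Prod.fst_sub,
    Prod.snd_sub] <;> gcongr

lemma disjoint_Icc_hypAt {Y : Set (ℝ × ℝ)} {z : ℝ × ℝ} {t : ℝ} (ht : 0 < t)
    (hY : ∀ y ∈ Y, hypAt z t⁻¹ y ∈ Y) {a b : ℝ × ℝ} (h : Disjoint (Icc a b) Y) :
    Disjoint (Icc (hypAt z t a) (hypAt z t b)) Y := by
  rw [Set.disjoint_left] at h ⊢
  intro y hy hyY
  have h1 := hypAt_mono z (inv_pos.2 ht) hy.1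
  have h2 := hypAt_mono z (inv_pos.2 ht) hy.2
  rw [hypAt_hypAt_inv z ht.ne'] at h1 h2
  exact h ⟨h1, h2⟩ (hY y hyY)

lemma IsChainOrigin.hypAt {X Y : Set (ℝ × ℝ)} {q z : ℝ × ℝ} {t : ℝ} (ht : 0 < t)
    (hX : ∀ y ∈ X, hypAt z t y ∈ X) (hY : ∀ y ∈ Y, Paper.hypAt z t⁻¹ y ∈ Y)
    (h : IsChainOrigin X Y q) : IsChainOrigin X Y (Paper.hypAt z t q) := by
  obtain ⟨w, rfl, h⟩ := h
  refine ⟨fun i => Paper.hypAt z t (w i), rfl, fun i => ⟨hX _ (h i).1, ?_, ?_,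
    disjoint_Icc_hypAt ht hY (h i).2.2.2⟩⟩
  · have := (h i).2.1
    simp only [Paper.hypAt, hyp, Prod.fst_add, Prod.fst_sub]
    gcongr
  · have := (h i).2.2.1
    simp only [Paper.hypAt, hyp, Prod.snd_add, Prod.snd_sub]
    gcongr

lemma IsChainOrigin.exists_long_step {X Y : Set (ℝ × ℝ)} {μ κ K : ℝ} (hμ : 1 < μ) (hκ : 0 < κ)
    (hXX : ∀ z ∈ X, ∀ z' ∈ X, z.1 < z'.1 → z.2 < z'.2 → κ ≤ (z'.1 - z.1) * (z'.2 - z.2))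
    (hXY : ∀ z ∈ X, ∀ y ∈ Y, κ ≤ |(y.1 - z.1) * (y.2 - z.2)|)
    (hK : ∀ a b : ℝ × ℝ, a.1 < b.1 → a.2 < b.2 → Disjoint (Icc a b) Y →
      (b.1 - a.1) * (b.2 - a.2) ≤ K)
    (hX : ∀ z ∈ X, ∀ n : ℤ, ∀ q ∈ X, Paper.hypAt z (μ ^ n) q ∈ X)
    (hY : ∀ z ∈ X, ∀ n : ℤ, ∀ q ∈ Y, Paper.hypAt z (μ ^ n) q ∈ Y)
    {z : ℝ × ℝ} (hz : IsChainOrigin X Y z) {a : ℝ} (ha : 0 < a) :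
    ∃ z', IsChainOrigin X Y z' ∧ z.1 < z'.1 ∧ z.2 < z'.2 ∧
      Disjoint (Icc (z.1 - a, z.2) z') Y ∧ a ≤ z'.1 - z.1 ∧ z'.1 - z.1 ≤ K * μ / κ * a := by
  obtain ⟨q, hq, hq1, hq2, hqY⟩ := hz.exists_next
  have hu : 0 < q.2 - z.2 := sub_pos.2 hq2
  have hs : 0 < q.1 - z.1 := sub_pos.2 hq1
  obtain ⟨n, hn1, hn2⟩ := exists_mem_Ioc_zpow (x := κ / a / (q.2 - z.2)) (by positivity) hμ
  have hpos : 0 < μ ^ n := by positivity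
  have hposn : 0 < μ ^ (-n) := by positivity
  rw [lt_div_iff₀ hu, lt_div_iff₀ ha] at hn1
  rw [div_le_iff₀ hu, div_le_iff₀ ha, zpow_add_one₀ (by positivity)] at hn2
  have hfix : Paper.hypAt z (μ ^ (-n)) z = z := by simp [Paper.hypAt, hyp]
  have hdisj : Disjoint (Icc z (Paper.hypAt z (μ ^ (-n)) q)) Y := by
    have := disjoint_Icc_hypAt (z := z) hposn
      (by rw [← _root_.zpow_neg]; exact hY z hz.mem _) hqY
    rwa [hfix] at this
  have horig : IsChainOrigin X Y (Paper.hypAt z (μ ^ (-n)) q) :=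
    hq.hypAt hposn (hX z hz.mem _) (by rw [← _root_.zpow_neg]; exact hY z hz.mem _)
  have e1 : (Paper.hypAt z (μ ^ (-n)) q).1 - z.1 = μ ^ (-n) * (q.1 - z.1) := by
    simp [Paper.hypAt, hyp]
  have e2 : (Paper.hypAt z (μ ^ (-n)) q).2 - z.2 = μ ^ n * (q.2 - z.2) := by
    simp [Paper.hypAt, hyp]
  generalize Paper.hypAt z (μ ^ (-n)) q = z' at *
  have hs' : 0 < z'.1 - z.1 := by rw [e1]; positivity
  have hu' : 0 < z'.2 - z.2 := by rw [e2]; positivity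
  rw [← e2] at hn1
  have hn2' : κ ≤ (z'.2 - z.2) * μ * a := by rw [e2]; linarith
  have hA := hXX z hz.mem z' horig.mem (sub_pos.1 hs') (sub_pos.1 hu')
  have hB := hK z z' (sub_pos.1 hs') (sub_pos.1 hu') hdisj
  refine ⟨z', horig, sub_pos.1 hs', sub_pos.1 hu', ?_, ?_, ?_⟩
  · rw [Set.disjoint_left] at hdisj ⊢
    rintro y ⟨⟨hy1, hy2⟩, hy3⟩ hyY
    simp only at hy1 hy2
    by_cases hy : z.1 ≤ y.1
    · exact hdisj ⟨⟨hy, hy2⟩, hy3⟩ hyY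
    · have hc := hXY z hz.mem y hyY
      have hy4 := hy3.2
      push Not at hy
      rw [abs_mul, abs_of_neg (sub_neg.2 hy), abs_of_nonneg (sub_nonneg.2 hy2)] at hc
      have : -(y.1 - z.1) * (y.2 - z.2) ≤ a * (z'.2 - z.2) := by
        gcongr
        linarith
      linarith
  · by_contra! h
    nlinarith
  · rw [div_mul_eq_mul_div, le_div_iff₀ hκ]
    calc (z'.1 - z.1) * κ ≤ (z'.1 - z.1) * ((z'.2 - z.2) * μ * a) := by gcongr
      _ = ((z'.1 - z.1) * (z'.2 - z.2)) * (μ * a) := by ring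
      _ ≤ K * (μ * a) := by gcongr
      _ = K * μ * a := by ring

lemma exists_staircase_points {X Y : Set (ℝ × ℝ)} {C : ℝ}
    (hstep : ∀ z, IsChainOrigin X Y z → ∀ a > 0, ∃ z', IsChainOrigin X Y z' ∧ z.1 < z'.1 ∧
      z.2 < z'.2 ∧ Disjoint (Icc (z.1 - a, z.2) z') Y ∧ a ≤ z'.1 - z.1 ∧ z'.1 - z.1 ≤ C * a)
    {x : ℝ × ℝ} (hx : IsChainOrigin X Y x) :
    ∃ w : ℕ → ℝ × ℝ, w 0 = x ∧ (∀ i, w i ∈ X ∧ (w i).1 < (w (i + 1)).1 ∧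
      (w i).2 < (w (i + 1)).2 ∧ Disjoint (Icc (x.1, (w i).2) (w (i + 1))) Y) ∧
      ∃ C' : ℝ, ∀ i, (w (i + 2)).1 - (w (i + 1)).1 ≤ C' * ((w (i + 1)).1 - (w i).1) := by
  obtain ⟨z, hz, hz1, hz2, hzY⟩ := hx.exists_next
  have hstep' : ∀ q : {q // IsChainOrigin X Y q ∧ x.1 < q.1},
      ∃ q' : {q // IsChainOrigin X Y q ∧ x.1 < q.1}, q.1.1 < q'.1.1 ∧ q.1.2 < q'.1.2 ∧
        Disjoint (Icc (x.1, q.1.2) q'.1) Y ∧ q.1.1 - x.1 ≤ q'.1.1 - q.1.1 ∧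
        q'.1.1 - q.1.1 ≤ C * (q.1.1 - x.1) := by
    rintro ⟨q, hq, hxq⟩
    obtain ⟨q', h1, h2, h3, h4, h5⟩ := hstep q hq (q.1 - x.1) (sub_pos.2 hxq)
    exact ⟨⟨q', h1, hxq.trans h2⟩, h2, h3, by simpa using h4, h5⟩
  choose next hn1 hn2 hn3 hn4 hn5 using hstep'
  let v : ℕ → {q // IsChainOrigin X Y q ∧ x.1 < q.1} := fun i => next^[i] ⟨z, hz, hz1⟩
  have hv : ∀ i, v (i + 1) = next (v i) := fun i => Function.iterate_succ_apply' _ _ _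
  have hgrow : ∀ i, (v i).1.1 - x.1 ≤ (v (i + 1)).1.1 - (v i).1.1 := fun i => by
    rw [hv]; exact hn4 _
  have hbound : ∀ i, (v (i + 1)).1.1 - (v i).1.1 ≤ C * ((v i).1.1 - x.1) := fun i => by
    rw [hv]; exact hn5 _
  have hC : 0 ≤ C := by
    have h1 := hgrow 0
    have h2 := hbound 0
    have h3 := (v 0).2.2
    by_contra! h
    nlinarith
  refine ⟨fun i => Nat.casesOn i x fun i => (v i).1, rfl, ?_, C * 2, ?_⟩
  · rintro (_ | i)
    · exact ⟨hx.mem, hz1, hz2, hzY⟩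
    · refine ⟨(v i).2.1.mem, ?_, ?_, ?_⟩
      · simp only [hv]; exact hn1 _
      · simp only [hv]; exact hn2 _
      · simp only [hv]; exact hn3 _
  · rintro (_ | i)
    · have h1 := hbound 0
      have h2 := (v 0).2.2
      simp only
      change _ ≤ C * 2 * ((v 0).1.1 - x.1)
      nlinarith
    · have h1 := hbound (i + 1)
      have h2 := hgrow i
      simp only
      calc _ ≤ _ := h1
        _ ≤ C * (2 * ((v (i + 1)).1.1 - (v i).1.1)) := by gcongr; linarith
        _ = _ := by ring

/-- The integer lattice as a subgroup. -/
def latticeSubgroup : AddSubgroup V := ((Int.castAddHom ℝ).compLeft (Fin 2)).range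

lemma exists_eigen_coords {A : Matrix (Fin 2) (Fin 2) ℤ} {lam : ℝ} (hlam : 1 < lam) {vs vu : V}
    (hvs : vs ≠ 0) (hvu : vu ≠ 0) (hAs : actR A vs = lam⁻¹ • vs) (hAu : actR A vu = lam • vu) :
    ∃ e : (ℝ × ℝ) ≃ₗ[ℝ] V, ∀ q, e q = q.1 • vs + q.2 • vu := by
  let f : (ℝ × ℝ) →ₗ[ℝ] V :=
    (LinearMap.toSpanSingleton ℝ V vs).coprod (LinearMap.toSpanSingleton ℝ V vu)
  have hf : ∀ q, f q = q.1 • vs + q.2 • vu := fun q => rfl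
  have hinj : Function.Injective f := by
    rw [← LinearMap.ker_eq_bot, LinearMap.ker_eq_bot']
    intro q hq
    rw [hf] at hq
    have h1 : actR A (q.1 • vs + q.2 • vu) = 0 := by rw [hq]; exact Matrix.mulVec_zero _
    rw [actR_add, actR_smul, actR_smul, hAs, hAu] at h1
    have h2 : (q.2 * (lam - lam⁻¹)) • vu = 0 := by
      have h3 : (q.2 * (lam - lam⁻¹)) • vu =
          (q.1 • lam⁻¹ • vs + q.2 • lam • vu) - lam⁻¹ • (q.1 • vs + q.2 • vu) := by
        module
      rw [h3, h1, hq, smul_zero, sub_zero]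
    have h4 : lam - lam⁻¹ ≠ 0 := by
      have := inv_lt_one_of_one_lt₀ hlam
      linarith
    have hq2 : q.2 = 0 := by
      simpa [hvu, h4] using h2
    have hq1 : q.1 = 0 := by
      simpa [hq2, hvs] using hq
    exact Prod.ext hq1 hq2
  refine ⟨LinearEquiv.ofInjectiveOfFinrankEq f hinj (by simp), fun q => ?_⟩
  exact hf q

lemma boxFinite_comap_lattice (e : (ℝ × ℝ) ≃ₗ[ℝ] V) :
    BoxFinite (e ⁻¹' lattice) := by
  intro r
  let M : ℤ := ⌈∑ i, r * (|e (1, 0) i| + |e (0, 1) i|)⌉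
  have hfin : ((fun m : Fin 2 → ℤ => e.symm fun i => (m i : ℝ)) ''
      Icc (fun _ => -M) (fun _ => M)).Finite := (Set.finite_Icc _ _).image _
  refine hfin.subset ?_
  rintro q ⟨⟨m, hm⟩, h1, h2⟩
  have hr : 0 ≤ r := (abs_nonneg _).trans h1
  have hb : ∀ i, |(m i : ℝ)| ≤ M := by
    intro i
    have e1 : (m i : ℝ) = q.1 * e (1, 0) i + q.2 * e (0, 1) i := by
      have h3 : q = q.1 • ((1, 0) : ℝ × ℝ) + q.2 • ((0, 1) : ℝ × ℝ) := by
        ext <;> simp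
      have h4 := congrFun hm i
      simp only at h4
      rw [h4]
      conv_lhs => rw [h3]
      simp only [map_add, map_smul, Pi.add_apply, Pi.smul_apply, smul_eq_mul]
    calc |(m i : ℝ)| ≤ |q.1 * e (1, 0) i| + |q.2 * e (0, 1) i| := by
          rw [e1]; exact abs_add_le _ _
      _ ≤ r * |e (1, 0) i| + r * |e (0, 1) i| := by
          rw [abs_mul, abs_mul]; gcongr
      _ = r * (|e (1, 0) i| + |e (0, 1) i|) := by ring
      _ ≤ ∑ i, r * (|e (1, 0) i| + |e (0, 1) i|) :=
          Finset.single_le_sum (f := fun i => r * (|e (1, 0) i| + |e (0, 1) i|))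
            (fun i _ => by positivity) (Finset.mem_univ i)
      _ ≤ M := Int.le_ceil _
  refine ⟨m, ⟨fun i => ?_, fun i => ?_⟩, ?_⟩
  · have := (abs_le.1 (hb i)).1
    exact_mod_cast this
  · have := (abs_le.1 (hb i)).2
    exact_mod_cast this
  · simp only
    rw [LinearEquiv.symm_apply_eq]
    exact hm

lemma BoxFinite.add_left {L : Set (ℝ × ℝ)} (hL : BoxFinite L) {F : Set (ℝ × ℝ)}
    (hF : F.Finite) : BoxFinite (F + L) := by
  intro r
  refine (hF.biUnion fun f _ => (hL (r + (|f.1| + |f.2|))).image fun l => f + l).subset ?_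
  rintro q ⟨⟨f, hf, l, hl, rfl⟩, h1, h2⟩
  simp only [Set.mem_iUnion]
  refine ⟨f, hf, l, ⟨hl, ?_, ?_⟩, rfl⟩
  · have := abs_sub (f.1 + l.1) f.1
    rw [add_sub_cancel_left] at this
    have h3 : |f.1 + l.1| ≤ r := h1
    linarith [abs_nonneg f.2]
  · have := abs_sub (f.2 + l.2) f.2
    rw [add_sub_cancel_left] at this
    have h3 : |f.2 + l.2| ≤ r := h2
    linarith [abs_nonneg f.1]

lemma BoxFinite.mono {D E : Set (ℝ × ℝ)} (hE : BoxFinite E) (h : D ⊆ E) : BoxFinite D :=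
  fun r => (hE r).subset (inter_subset_inter_left _ h)

lemma HypInvariant.sub {lam : ℝ} {D E : Set (ℝ × ℝ)} (hD : HypInvariant lam D)
    (hE : HypInvariant lam E) : HypInvariant lam (D - E) := by
  rintro n _ ⟨d, hd, f, hf, rfl⟩
  exact ⟨_, hD n d hd, _, hE n f hf, (hyp_sub _ _ _).symm⟩

lemma exists_lattice_near (e : (ℝ × ℝ) ≃ₗ[ℝ] V) :
    ∃ M > 0, ∀ w : ℝ × ℝ, ∃ l, e l ∈ lattice ∧ |(w - l).1| ≤ M ∧ |(w - l).2| ≤ M := by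
  set c := e.symm ![1, 0] with hc
  set d := e.symm ![0, 1] with hd
  refine ⟨|c.1| + |c.2| + |d.1| + |d.2| + 1, by positivity, fun w => ?_⟩
  refine ⟨e.symm fun i => (⌊e w i⌋ : ℝ), ⟨fun i => ⌊e w i⌋, by simp⟩, ?_⟩
  have h : w - e.symm (fun i => (⌊e w i⌋ : ℝ)) =
      Int.fract (e w 0) • c + Int.fract (e w 1) • d := by
    apply e.injective
    rw [map_sub, LinearEquiv.apply_symm_apply, map_add, map_smul, map_smul, hc, hd,
      LinearEquiv.apply_symm_apply, LinearEquiv.apply_symm_apply]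
    funext i
    fin_cases i <;> simp [-Int.self_sub_floor, ← Int.self_sub_floor]
  have hfr : ∀ i : Fin 2, ∀ y : ℝ, |Int.fract (e w i) * y| ≤ |y| := by
    intro i y
    rw [abs_mul, abs_of_nonneg (Int.fract_nonneg _)]
    exact mul_le_of_le_one_left (abs_nonneg _) (Int.fract_lt_one _).le
  rw [h]
  constructor
  · calc _ ≤ |Int.fract (e w 0) * c.1| + |Int.fract (e w 1) * d.1| := abs_add_le _ _
      _ ≤ |c.1| + |d.1| := add_le_add (hfr _ _) (hfr _ _)
      _ ≤ _ := by linarith [abs_nonneg c.2, abs_nonneg d.2]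
  · calc _ ≤ |Int.fract (e w 0) * c.2| + |Int.fract (e w 1) * d.2| := abs_add_le _ _
      _ ≤ |c.2| + |d.2| := add_le_add (hfr _ _) (hfr _ _)
      _ ≤ _ := by linarith [abs_nonneg c.1, abs_nonneg d.1]

lemma exists_staircase_points_of_lattice {lam : ℝ} (hlam : 1 < lam) {X Y FX FY : Set (ℝ × ℝ)}
    {L : AddSubgroup (ℝ × ℝ)} (hX : HypInvariant lam X) (hY : HypInvariant lam Y)
    (hL : ∀ l ∈ L, hyp lam⁻¹ l ∈ L) (hLfin : BoxFinite (L : Set (ℝ × ℝ)))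
    (hLdense : ∃ M > 0, ∀ w : ℝ × ℝ, ∃ l ∈ L, |(w - l).1| ≤ M ∧ |(w - l).2| ≤ M)
    (hFX : FX.Finite) (hXF : X = FX + (L : Set (ℝ × ℝ)))
    (hFY : FY.Finite) (hYF : Y = FY + (L : Set (ℝ × ℝ)))
    (hXY : Disjoint X Y) (hYne : Y.Nonempty) {x : ℝ × ℝ} (hx : IsChainOrigin X Y x) :
    ∃ w : ℕ → ℝ × ℝ, w 0 = x ∧ (∀ i, w i ∈ X ∧ (w i).1 < (w (i + 1)).1 ∧
      (w i).2 < (w (i + 1)).2 ∧ Disjoint (Icc (x.1, (w i).2) (w (i + 1))) Y) ∧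
      ∃ C' : ℝ, ∀ i, (w (i + 2)).1 - (w (i + 1)).1 ≤ C' * ((w (i + 1)).1 - (w i).1) := by
  have hfin : ∀ {E G FE FG : Set (ℝ × ℝ)}, FE.Finite → FG.Finite →
      E = FE + (L : Set (ℝ × ℝ)) → G = FG + (L : Set (ℝ × ℝ)) → BoxFinite (E - G) := by
    rintro E G FE FG hE hG rfl rfl
    refine (hLfin.add_left (hE.sub hG)).mono ?_
    rintro _ ⟨_, ⟨f, hf, l, hl, rfl⟩, _, ⟨g, hg, m, hm, rfl⟩, rfl⟩
    exact ⟨f - g, ⟨f, hf, g, hg, rfl⟩, l - m, L.sub_mem hl hm, by simp only; abel⟩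
  have hadd : ∀ {E FE : Set (ℝ × ℝ)}, E = FE + (L : Set (ℝ × ℝ)) →
      ∀ z ∈ E, ∀ l ∈ L, z + l ∈ E := by
    rintro E FE rfl _ ⟨f, hf, m, hm, rfl⟩ l hl
    exact ⟨f, hf, m + l, L.add_mem hm hl, (add_assoc _ _ _).symm⟩
  obtain ⟨κ₁, hκ₁, hgap₁⟩ := exists_le_abs_mul hlam (hX.sub hX) (hfin hFX hFX hXF hXF)
  obtain ⟨κ₂, hκ₂, hgap₂⟩ := exists_le_abs_mul hlam (hY.sub hX) (hfin hFY hFX hYF hXF)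
  obtain ⟨K, hK⟩ : ∃ K, ∀ a b : ℝ × ℝ, a.1 < b.1 → a.2 < b.2 → Disjoint (Icc a b) Y →
      (b.1 - a.1) * (b.2 - a.2) ≤ K := by
    obtain ⟨M, hM, hnear⟩ := hLdense
    obtain ⟨y, hy⟩ := hYne
    refine exists_area_le hlam hY (r := 2 * M) (by positivity) fun q => ?_
    obtain ⟨l, hl, h1, h2⟩ := hnear (q + (M, M) - y)
    refine ⟨y + l, hadd hYF y hy l hl, ?_⟩
    rw [abs_le] at h1 h2
    simp only [Prod.fst_add, Prod.snd_add, Prod.fst_sub, Prod.snd_sub] at h1 h2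
    refine ⟨⟨?_, ?_⟩, ⟨?_, ?_⟩⟩ <;> simp only [Prod.fst_add, Prod.snd_add] <;> linarith
  obtain ⟨p, hp, hper⟩ := exists_period hlam hX hL hFX hXF
  have hpow : ∀ {E FE : Set (ℝ × ℝ)}, HypInvariant lam E → E = FE + (L : Set (ℝ × ℝ)) →
      ∀ z ∈ X, ∀ n : ℤ, ∀ q ∈ E, hypAt z ((lam ^ p) ^ n) q ∈ E := by
    intro E FE hE hEF z hz n q hq
    have h1 := hE (p * n) q hq
    rw [_root_.zpow_mul, zpow_natCast] at h1
    have h2 := hadd hEF _ h1 _ (L.neg_mem (hper n z hz))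
    convert h2 using 1
    simp only [hypAt, hyp_sub]
    abel
  refine exists_staircase_points (C := K * lam ^ p / min κ₁ κ₂) (fun z hz a ha => ?_) hx
  refine hz.exists_long_step (one_lt_pow₀ hlam hp.ne') (lt_min hκ₁ hκ₂) ?_ ?_ hK
    (hpow hX hXF) (hpow hY hYF) ha
  · intro z hz z' hz' h1 h2
    have h1' := sub_pos.2 h1
    have h2' := sub_pos.2 h2
    have := hgap₁ (z' - z) ⟨z', hz', z, hz, rfl⟩ h1'.ne' h2'.ne'
    rw [Prod.fst_sub, Prod.snd_sub, abs_of_pos (mul_pos h1' h2')] at this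
    exact (min_le_left _ _).trans this
  · intro z hz y hy
    have hmem : y - z ∈ Y - X := ⟨y, hy, z, hz, rfl⟩
    have hne : ¬((y - z).1 = 0 ∨ (y - z).2 = 0) := by
      intro h0
      have := eq_zero_of_mem_axis hlam (hY.sub hX) (hfin hFY hFX hYF hXF) hmem h0
      rw [sub_eq_zero] at this
      exact Set.disjoint_left.1 hXY hz (this ▸ hy)
    push Not at hne
    exact (min_le_right _ _).trans (hgap₂ _ hmem hne.1 hne.2)

/-- The rectangle spanned by two points given in eigen-coordinates. -/
def rectOf (e : (ℝ × ℝ) ≃ₗ[ℝ] V) (a b : ℝ × ℝ) (h1 : a.1 < b.1) (h2 : a.2 < b.2) : Rect where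
  p := e a
  s := b.1 - a.1
  u := b.2 - a.2
  s_pos := sub_pos.2 h1
  u_pos := sub_pos.2 h2

section Coordinates

variable {vs vu : V} {e : (ℝ × ℝ) ≃ₗ[ℝ] V}

lemma mem_carrier_iff (he : ∀ q, e q = q.1 • vs + q.2 • vu) (R : Rect) (q : ℝ × ℝ) :
    e q ∈ R.carrier vs vu ↔ q ∈ Icc (e.symm R.p) (e.symm R.p + (R.s, R.u)) := by
  have key : ∀ a b : ℝ, R.p + a • vs + b • vu = e (e.symm R.p + (a, b)) := by
    intro a b
    rw [map_add, e.apply_symm_apply, he (a, b), add_assoc]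
  constructor
  · rintro ⟨a, b, ha, ha', hb, hb', h⟩
    rw [key] at h
    rw [e.injective h]
    refine ⟨⟨?_, ?_⟩, ⟨?_, ?_⟩⟩ <;> simpa
  · rintro ⟨⟨h1, h2⟩, h3, h4⟩
    refine ⟨q.1 - (e.symm R.p).1, q.2 - (e.symm R.p).2, sub_nonneg.2 h1, ?_, sub_nonneg.2 h2,
      ?_, ?_⟩
    · exact sub_le_iff_le_add'.2 h3
    · exact sub_le_iff_le_add'.2 h4
    · rw [key]
      congr 1
      ext <;> simp

lemma mem_carrier_rectOf_iff (he : ∀ q, e q = q.1 • vs + q.2 • vu) {a b : ℝ × ℝ}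
    (h1 : a.1 < b.1) (h2 : a.2 < b.2) (q : ℝ × ℝ) :
    e q ∈ (rectOf e a b h1 h2).carrier vs vu ↔ q ∈ Icc a b := by
  rw [mem_carrier_iff he]
  have : a + (b.1 - a.1, b.2 - a.2) = b := by ext <;> simp
  simp [rectOf, this]

lemma incEnd_rectOf (he : ∀ q, e q = q.1 • vs + q.2 • vu) {a b : ℝ × ℝ}
    (h1 : a.1 < b.1) (h2 : a.2 < b.2) : (rectOf e a b h1 h2).incEnd vs vu = e b := by
  simp only [Rect.incEnd, rectOf, he]
  module

lemma disjoint_carrier_rectOf (he : ∀ q, e q = q.1 • vs + q.2 • vu) {a b : ℝ × ℝ}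
    (h1 : a.1 < b.1) (h2 : a.2 < b.2) {Y : Set V} (h : Disjoint (Icc a b) (e ⁻¹' Y)) :
    Disjoint ((rectOf e a b h1 h2).carrier vs vu) Y := by
  rw [Set.disjoint_left] at h ⊢
  intro v hv hvY
  obtain ⟨q, rfl⟩ := e.surjective v
  exact h ((mem_carrier_rectOf_iff he h1 h2 q).1 hv) hvY

lemma isChainOrigin_of_isPosString (he : ∀ q, e q = q.1 • vs + q.2 • vu) {X Y : Set V} {x : V}
    {Del : ℕ → Rect} (hDel : IsPosString vs vu X x Del)
    (hdisj : ∀ i, Disjoint ((Del i).carrier vs vu) Y) :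
    IsChainOrigin (e ⁻¹' X) (e ⁻¹' Y) (e.symm x) := by
  obtain ⟨hpos, h0, hnext⟩ := hDel
  have hsucc : ∀ i, e.symm (Del (i + 1)).p = e.symm (Del i).p + ((Del i).s, (Del i).u) := by
    intro i
    rw [(hnext i).2, e.symm_apply_eq, map_add, e.apply_symm_apply, he, Rect.incEnd, add_assoc]
  refine ⟨fun i => e.symm (Del i).p, congrArg e.symm h0, fun i => ⟨?_, ?_, ?_, ?_⟩⟩
  · simpa using (hpos i).1
  · simpa only [hsucc, Prod.fst_add, lt_add_iff_pos_right] using (Del i).s_pos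
  · simpa only [hsucc, Prod.snd_add, lt_add_iff_pos_right] using (Del i).u_pos
  · rw [Set.disjoint_left]
    intro q hq hqY
    simp only [hsucc] at hq
    exact Set.disjoint_left.1 (hdisj i) ((mem_carrier_iff he _ _).2 hq) hqY

lemma exists_isPosStaircase (he : ∀ q, e q = q.1 • vs + q.2 • vu) {X Y : Set V} {x : V}
    {w : ℕ → ℝ × ℝ} (h0 : w 0 = e.symm x) (hX : ∀ i, e (w i) ∈ X)
    (h1 : ∀ i, (w i).1 < (w (i + 1)).1) (h2 : ∀ i, (w i).2 < (w (i + 1)).2)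
    (hY : ∀ i, Disjoint (Icc ((w 0).1, (w i).2) (w (i + 1))) (e ⁻¹' Y)) {C : ℝ}
    (hC : ∀ i, (w (i + 2)).1 - (w (i + 1)).1 ≤ C * ((w (i + 1)).1 - (w i).1)) :
    ∃ R : ℕ → Rect, IsPosStaircase vs vu X x R ∧
      ∀ i, Disjoint ((R i).carrier vs vu) Y := by
  have hm1 : StrictMono fun i => (w i).1 := strictMono_nat_of_lt_succ h1
  have hm2 : StrictMono fun i => (w i).2 := strictMono_nat_of_lt_succ h2
  have hle1 : ∀ i, (w 0).1 ≤ (w i).1 := fun i => hm1.monotone (Nat.zero_le i)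
  have hle2 : ∀ i, (w 0).2 ≤ (w i).2 := fun i => hm2.monotone (Nat.zero_le i)
  have hlt : ∀ i, (w 0).1 < (w (i + 1)).1 := fun i => hm1 i.succ_pos
  have hx : x = e (w 0) := by rw [h0, e.apply_symm_apply]
  refine ⟨fun i => rectOf e ((w 0).1, (w i).2) (w (i + 1)) (hlt i) (h2 i), ⟨?_,
    fun i => rectOf e (w i) (w (i + 1)) (h1 i) (h2 i), ⟨?_, ?_, ?_⟩, ?_, ?_, ?_, C, ?_⟩,
    fun i => disjoint_carrier_rectOf he _ _ (hY i)⟩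
  · intro i v hv
    obtain ⟨q, rfl⟩ := e.surjective v
    rw [mem_carrier_rectOf_iff he] at hv
    refine ⟨q.1 - (w 0).1, q.2 - (w 0).2, sub_nonneg.2 hv.1.1,
      sub_nonneg.2 ((hle2 i).trans hv.1.2), ?_⟩
    rw [hx, he, he]
    module
  · intro i
    refine ⟨hX i, ?_⟩
    rw [incEnd_rectOf he]
    exact hX _
  · exact hx.symm
  · intro i
    rw [incEnd_rectOf he]
    refine ⟨?_, rfl⟩
    ext v
    obtain ⟨q, rfl⟩ := e.surjective v
    rw [Set.mem_inter_iff, mem_carrier_rectOf_iff he, mem_carrier_rectOf_iff he,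
      Set.mem_singleton_iff, e.injective.eq_iff]
    constructor
    · rintro ⟨ha, hb⟩
      exact le_antisymm ha.2 hb.1
    · rintro rfl
      exact ⟨⟨⟨(h1 i).le, (h2 i).le⟩, le_rfl⟩, ⟨le_rfl, (h1 (i + 1)).le, (h2 (i + 1)).le⟩⟩
  · rfl
  · intro i _
    refine ⟨?_, rfl, ?_⟩
    · simp only [rectOf]
      linarith [hle1 i]
    · simp only [rectOf, he]
      module
  · rintro i v ⟨a, ha, ha', rfl⟩
    refine ⟨a, ha, ha'.trans ?_, ?_⟩
    · simp only [rectOf]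
      linarith [h1 (i + 1)]
    · simp only [rectOf, he]
      module
  · intro i
    rw [div_le_iff₀ (Rect.s_pos _)]
    exact hC i

lemma IsInvariant.hypInvariant {A : Matrix (Fin 2) (Fin 2) ℤ} {lam : ℝ} (hlam : 1 < lam)
    (hAe : ∀ q, actR A (e q) = e (hyp lam⁻¹ q)) {E : Set V} (hE : IsInvariant A E) :
    HypInvariant lam (e ⁻¹' E) := by
  have h0 : lam ≠ 0 := by positivity
  refine hypInvariant_of_one hlam ?_ ?_
  · intro q hq
    have hq' : e q ∈ actR A '' E := by rw [hE]; exact hq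
    obtain ⟨v, hv, h⟩ := hq'
    obtain ⟨r, rfl⟩ := e.surjective v
    rw [hAe] at h
    rw [← e.injective h, hyp_hyp, mul_inv_cancel₀ h0, hyp_one]
    exact hv
  · intro q hq
    have : actR A (e q) ∈ actR A '' E := ⟨_, hq, rfl⟩
    rw [hE, hAe] at this
    exact this

lemma IsTorusFinite.exists_preimage_eq (e : (ℝ × ℝ) ≃ₗ[ℝ] V) {E : Set V} (hE : IsTorusFinite E) :
    ∃ F : Set (ℝ × ℝ), F.Finite ∧ e ⁻¹' E = F + e ⁻¹' lattice := by
  obtain ⟨F, hF, rfl⟩ := hE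
  refine ⟨e ⁻¹' F, hF.preimage e.injective.injOn, ?_⟩
  ext q
  constructor
  · rintro ⟨f, hf, l, hl, h⟩
    refine ⟨e.symm f, by simpa using hf, e.symm l, by simpa using hl, ?_⟩
    simp only
    rw [← map_add, e.symm_apply_eq]
    exact h
  · rintro ⟨f, hf, l, hl, rfl⟩
    exact ⟨e f, hf, e l, hl, (map_add e f l).symm⟩

end Coordinates

/-- a positive `𝒳`-string with origin `x` disjoint from `𝒴̃` yields
a positive `𝒳`-staircase with origin `x` disjoint from `𝒴̃`. -/
theorem statement_7 (A : Matrix (Fin 2) (Fin 2) ℤ) (hdet : A.det = 1) (htr : 2 < A.trace)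
    (lam : ℝ) (hlam : 1 < lam) (vs vu : V) (hvs : vs ≠ 0) (hvu : vu ≠ 0)
    (hAs : actR A vs = lam⁻¹ • vs) (hAu : actR A vu = lam • vu)
    (X Y : Set V) (hXY : Disjoint X Y)
    (hXfin : IsTorusFinite X) (hXinv : IsInvariant A X)
    (hYfin : IsTorusFinite Y) (hYinv : IsInvariant A Y) (hYne : Y.Nonempty)
    (x : V) (hx : x ∈ X)
    (h : ∃ Del : ℕ → Rect, IsPosString vs vu X x Del ∧
      ∀ i, Disjoint ((Del i).carrier vs vu) Y) :
    ∃ R : ℕ → Rect, IsPosStaircase vs vu X x R ∧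
      ∀ i, Disjoint ((R i).carrier vs vu) Y := by
  obtain ⟨e, he⟩ := exists_eigen_coords hlam hvs hvu hAs hAu
  have hAe : ∀ q, actR A (e q) = e (hyp lam⁻¹ q) := by
    intro q
    rw [he, he, actR_add, actR_smul, actR_smul, hAs, hAu]
    simp only [hyp, inv_inv]
    module
  obtain ⟨Del, hDel, hdisj⟩ := h
  obtain ⟨FX, hFX, hXF⟩ := hXfin.exists_preimage_eq e
  obtain ⟨FY, hFY, hYF⟩ := hYfin.exists_preimage_eq e
  obtain ⟨w, h0, hw, C, hC⟩ := exists_staircase_points_of_lattice hlam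
    (L := latticeSubgroup.comap (e : (ℝ × ℝ) →+ V))
    (hXinv.hypInvariant hlam hAe) (hYinv.hypInvariant hlam hAe)
    (fun l hl => by
      have : actR A (e l) ∈ lattice := actR_mem_lattice A hl
      rw [hAe] at this
      exact this)
    (boxFinite_comap_lattice e) (exists_lattice_near e) hFX hXF hFY hYF (hXY.preimage e)
    (hYne.preimage e.surjective) (isChainOrigin_of_isPosString he hDel hdisj)
  refine exists_isPosStaircase he h0 (fun i => (hw i).1) (fun i => (hw i).2.1)
    (fun i => (hw i).2.2.1) (fun i => ?_) hC
  rw [h0]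
  exact (hw i).2.2.2

end Paper
end
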